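/- For any k ≥ 0 there exists a constant ρ = ρ(k) such that for any two conjugate elements f, g of G with max{|f|_{X∪𝓗}, |g|_{X∪𝓗}} ≤ k there exists an element t ∈ G with f^t = g and |t|_{X∪𝓗} ≤ ρ. -/

import Mathlib

namespace RelHyp

variable {G : Type*} [Group G] {Λ : Type*}

/-- Length of a shortest word over the alphabet `S ∪ S⁻¹` representing `g`. -/
noncomputable def wordLength (S : Set G) (g : G) : ℕ :=
  sInf {n | ∃ w : List G, w.length = n ∧ (∀ x ∈ w, x ∈ S ∨ x⁻¹ ∈ S) ∧ w.prod = g}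

/-- The free product `F = (∗_λ H_λ) ∗ F(X)`. -/
abbrev RelFree (H : Λ → Subgroup G) (X : Set G) : Type _ :=
  Monoid.Coprod (Monoid.CoprodI fun l => ↥(H l)) (FreeGroup ↥X)

/-- The canonical homomorphism `ε : F → G`. -/
def relEps (H : Λ → Subgroup G) (X : Set G) : RelFree H X →* G :=
  Monoid.Coprod.lift (Monoid.CoprodI.lift fun l => (H l).subtype)
    (FreeGroup.lift fun x => (x : G))

/-- Letters of the alphabet `X ∪ 𝓗`, where `𝓗 = ⊔_λ (H̃_λ ∖ {1})`. -/
abbrev RelLetter (H : Λ → Subgroup G) (X : Set G) : Type _ :=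
  (Σ l : Λ, {h : ↥(H l) // h ≠ 1}) ⊕ (↥X × Bool)

/-- The image of a letter in the free product `F`. -/
def RelLetter.toF {H : Λ → Subgroup G} {X : Set G} : RelLetter H X → RelFree H X
  | Sum.inl ⟨_, h⟩ => Monoid.Coprod.inl (Monoid.CoprodI.of h.1)
  | Sum.inr (x, b) => Monoid.Coprod.inr (if b then FreeGroup.of x else (FreeGroup.of x)⁻¹)

/-- The element of `G` represented by a letter. -/
def RelLetter.val {H : Λ → Subgroup G} {X : Set G} : RelLetter H X → G
  | Sum.inl ⟨_, h⟩ => (h.1 : G)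
  | Sum.inr (x, b) => if b then (x : G) else (x : G)⁻¹

/-- The index `λ` such that the letter belongs to `H̃_λ`, if any. -/
def RelLetter.hIndex {H : Λ → Subgroup G} {X : Set G} : RelLetter H X → Option Λ
  | Sum.inl ⟨l, _⟩ => some l
  | Sum.inr _ => none

/-- The element of `F` represented by a word over `X ∪ 𝓗`. -/
def wordToF {H : Λ → Subgroup G} {X : Set G} (w : List (RelLetter H X)) : RelFree H X :=
  (w.map RelLetter.toF).prod

/-- `f` is a relative isoperimetric function of the relative presentation `⟨X, H | R⟩`. -/
def IsIsoperFn (H : Λ → Subgroup G) (X : Set G) (R : Set (RelFree H X)) (f : ℕ → ℕ) : Prop :=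
  ∀ w : List (RelLetter H X), relEps H X (wordToF w) = 1 →
    ∃ k ≤ f w.length, ∃ r c : Fin k → RelFree H X,
      (∀ i, r i ∈ R) ∧ wordToF w = (List.ofFn fun i => (c i)⁻¹ * r i * c i).prod

/-- `⟨X, H | R⟩` is a finite relative presentation of `G` w.r.t. the collection `H`. -/
structure IsFiniteRelPres (H : Λ → Subgroup G) (X : Set G) (R : Set (RelFree H X)) : Prop where
  finX : X.Finite
  finR : R.Finite
  surj : Function.Surjective (relEps H X)
  ker : (relEps H X).ker = Subgroup.normalClosure R

/-- `G` is finitely presented relative to the collection of subgroups `H`. -/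
def FinitelyPresentedRel (H : Λ → Subgroup G) : Prop :=
  ∃ (X : Set G) (R : Set (RelFree H X)), IsFiniteRelPres H X R

/-- The relative area of a word representing `1`. -/
noncomputable def relArea (H : Λ → Subgroup G) (X : Set G) (R : Set (RelFree H X))
    (w : List (RelLetter H X)) : ℕ :=
  sInf {k | ∃ r c : Fin k → RelFree H X,
    (∀ i, r i ∈ R) ∧ wordToF w = (List.ofFn fun i => (c i)⁻¹ * r i * c i).prod}

/-- The relative Dehn function of the presentation `⟨X, H | R⟩`. -/
noncomputable def relDehn (H : Λ → Subgroup G) (X : Set G) (R : Set (RelFree H X))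
    (n : ℕ) : ℕ :=
  sSup {a | ∃ w : List (RelLetter H X), w.length ≤ n ∧ relEps H X (wordToF w) = 1 ∧
    a = relArea H X R w}

/-- The relative Dehn function is well-defined (finite for each value of the argument),
i.e. there exists a finite-valued relative isoperimetric function. -/
def DehnWellDefined (H : Λ → Subgroup G) (X : Set G) (R : Set (RelFree H X)) : Prop :=
  ∃ f : ℕ → ℕ, IsIsoperFn H X R f

/-- `f ⪯ g`. -/
def AsympLE (f g : ℕ → ℕ) : Prop := ∃ C K L : ℕ, ∀ n, f n ≤ C * g (K * n) + L * n

/-- `f ∼ g`. -/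
def AsympEquiv (f g : ℕ → ℕ) : Prop := AsympLE f g ∧ AsympLE g f

/-- `G` is hyperbolic relative to `H`: it admits a finite relative presentation with a
linear relative isoperimetric function. -/
def IsRelHyperbolic (H : Λ → Subgroup G) : Prop :=
  ∃ (X : Set G) (R : Set (RelFree H X)), IsFiniteRelPres H X R ∧
    ∃ A B : ℕ, IsIsoperFn H X R fun n => A * n + B

/-- The subnegative closure of `f`. -/
noncomputable def subnegClosure (f : ℕ → ℕ) (n : ℕ) : ℕ :=
  sSup {s | ∃ L : List ℕ, (∀ a ∈ L, 0 < a) ∧ L.sum = n ∧ s = (L.map f).sum}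

/-- A combinatorial path in the Cayley graph `Γ(G, X ∪ 𝓗)`: a starting vertex
together with the word labelling the path. -/
structure RelPath (H : Λ → Subgroup G) (X : Set G) where
  start : G
  word : List (RelLetter H X)

namespace RelPath

variable {H : Λ → Subgroup G} {X : Set G}

/-- The length of the path. -/
def len (p : RelPath H X) : ℕ := p.word.length

/-- The `k`-th vertex of the path. -/
def vertex (p : RelPath H X) (k : ℕ) : G :=
  p.start * ((p.word.take k).map RelLetter.val).prod

/-- The terminal vertex of the path. -/
def finish (p : RelPath H X) : G := p.vertex p.word.length

end RelPath

/-- The combinatorial metric `dist_{X ∪ 𝓗}` on `G`. -/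
noncomputable def relDist (H : Λ → Subgroup G) (X : Set G) (g h : G) : ℕ :=
  wordLength (X ∪ ⋃ l, (H l : Set G)) (g⁻¹ * h)

/-- The relative length `|g|_{X ∪ 𝓗}`. -/
noncomputable def relLen (H : Λ → Subgroup G) (X : Set G) (g : G) : ℕ :=
  wordLength (X ∪ ⋃ l, (H l : Set G)) g

/-- The word metric `dist_X` on `G`. -/
noncomputable def xDist (X : Set G) (g h : G) : ℕ := wordLength X (g⁻¹ * h)

variable {H : Λ → Subgroup G} {X : Set G}

/-- `p` is a `(λ, c)`-quasi-geodesic in `Γ(G, X ∪ 𝓗)`. -/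
def IsQuasiGeodesic (lam c : ℝ) (p : RelPath H X) : Prop :=
  ∀ i j : ℕ, i ≤ j → j ≤ p.len →
    ((j - i : ℕ) : ℝ) ≤ lam * (relDist H X (p.vertex i) (p.vertex j) : ℝ) + c

/-- `p` is a geodesic in `Γ(G, X ∪ 𝓗)`. -/
def IsGeodesic (p : RelPath H X) : Prop :=
  ∀ i j : ℕ, i ≤ j → j ≤ p.len → j - i = relDist H X (p.vertex i) (p.vertex j)

/-- The `k`-th letter of `p` is a letter of `H̃_l`. -/
def LetterIsH (p : RelPath H X) (l : Λ) (k : ℕ) : Prop :=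
  ∃ a, p.word[k]? = some a ∧ a.hIndex = some l

/-- The subpath of `p` consisting of the letters with indices `a, …, b` is an
`H_l`-component of `p` (a maximal nonempty `H_l`-subword). -/
def IsComponent (p : RelPath H X) (l : Λ) (a b : ℕ) : Prop :=
  a ≤ b ∧ b < p.len ∧ (∀ k, a ≤ k → k ≤ b → LetterIsH p l k) ∧
    (a = 0 ∨ ¬ LetterIsH p l (a - 1)) ∧ (b + 1 = p.len ∨ ¬ LetterIsH p l (b + 1))

/-- The `H_l`-components of `p` starting at index `a` and of `q` starting at `a'`
are connected (their vertices lie in the same left coset of `H_l`). -/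
def ConnectedComp (p q : RelPath H X) (l : Λ) (a a' : ℕ) : Prop :=
  (p.vertex a)⁻¹ * q.vertex a' ∈ H l

/-- `p` is a path without backtracking: all of its components are isolated. -/
def NoBacktracking (p : RelPath H X) : Prop :=
  ∀ l a b a' b', IsComponent p l a b → IsComponent p l a' b' →
    ConnectedComp p p l a a' → a = a' ∧ b = b'

/-- The `k`-th vertex of `p` is a phase vertex (not an inner vertex of a component). -/
def IsPhase (p : RelPath H X) (k : ℕ) : Prop :=
  ¬ ∃ l a b, IsComponent p l a b ∧ a < k ∧ k ≤ b

/-- `p` and `q` are `k`-similar: their endpoints are `X`-distance at most `k` apart. -/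
def Similar (k : ℝ) (p q : RelPath H X) : Prop :=
  (xDist X p.start q.start : ℝ) ≤ k ∧ (xDist X p.finish q.finish : ℝ) ≤ k

/-- The Rips thin-triangles condition for `Γ(G, X ∪ 𝓗)` with constant `δ`. -/
def RipsThin (H : Λ → Subgroup G) (X : Set G) (δ : ℝ) : Prop :=
  ∀ p q r : RelPath H X, IsGeodesic p → IsGeodesic q → IsGeodesic r →
    p.finish = q.start → q.finish = r.start → r.finish = p.start →
    ∀ i ≤ p.len, ∃ j : ℕ,
      (j ≤ q.len ∧ (relDist H X (p.vertex i) (q.vertex j) : ℝ) ≤ δ) ∨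
      (j ≤ r.len ∧ (relDist H X (p.vertex i) (r.vertex j) : ℝ) ≤ δ)

/-- The Cayley graph `Γ(G, X ∪ 𝓗)` is a hyperbolic metric space. -/
def CayleyHyperbolic (H : Λ → Subgroup G) (X : Set G) : Prop :=
  ∃ δ : ℝ, 0 ≤ δ ∧ RipsThin H X δ

/-- `R` is a relatively quasi-convex subgroup of `G`. -/
def RelQuasiconvex (H : Λ → Subgroup G) (X : Set G) (R : Subgroup G) : Prop :=
  ∃ σ : ℝ, 0 < σ ∧ ∀ p : RelPath H X, IsGeodesic p → p.start ∈ R → p.finish ∈ R →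
    ∀ k ≤ p.len, ∃ w ∈ R, (xDist X (p.vertex k) w : ℝ) ≤ σ

/-- `R` is a strongly relatively quasi-convex subgroup of `G`. -/
def StronglyRelQuasiconvex (H : Λ → Subgroup G) (X : Set G) (R : Subgroup G) : Prop :=
  RelQuasiconvex H X R ∧ ∀ (g : G) (l : Λ), {x : G | x ∈ R ∧ g * x * g⁻¹ ∈ H l}.Finite

/-- `g` is a hyperbolic element: it is not conjugate to an element of any `H_λ`. -/
def IsHypElt (H : Λ → Subgroup G) (g : G) : Prop :=
  ∀ l : Λ, ∀ x ∈ H l, ¬ IsConj g x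

end RelHyp

open RelHyp

namespace RelHyp

section CrossedHom

variable {G : Type*} [Group G] {Λ : Type*} {H : Λ → Subgroup G} {X : Set G}

/-- The action of `G` on integer-valued functions on `G` by right translation. -/
def translateAct (G : Type*) [Group G] : G →* MulAut (G → Multiplicative ℤ) where
  toFun g :=
    { toFun := fun θ u => θ (u * g)
      invFun := fun θ u => θ (u * g⁻¹)
      left_inv := fun θ => by ext u; simp
      right_inv := fun θ => by ext u; simp
      map_mul' := fun _ _ => rfl }
  map_one' := by ext θ u; simp
  map_mul' g g' := by ext θ u; simp [mul_assoc]

/-- The homomorphism to the semidirect product encoding the crossed homomorphism determined by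
values `a x u` on the edges `u → u x` and potentials `b l` on the cosets of `H l`. -/
def crossedHom (a : ↥X → G → ℤ) (b : Λ → G → ℤ) :
    RelFree H X →* (G → Multiplicative ℤ) ⋊[translateAct G] G :=
  Monoid.Coprod.lift
    (Monoid.CoprodI.lift fun l =>
      { toFun := fun h => ⟨fun u => Multiplicative.ofAdd (b l (u * h) - b l u), h⟩
        map_one' := by
          ext
          · simp
          · simp
        map_mul' := fun h h' => by
          ext u
          · change Multiplicative.ofAdd _ = Multiplicative.ofAdd (b l (u * h) - b l u) *
              Multiplicative.ofAdd (b l (u * h * h') - b l (u * h))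
            rw [← ofAdd_add, Subgroup.coe_mul, mul_assoc]
            exact congrArg Multiplicative.ofAdd (sub_add_sub_cancel' _ _ _).symm
          · simp })
    (FreeGroup.lift fun x => ⟨fun u => Multiplicative.ofAdd (a x u), x⟩)

/-- The sum of the edge values along the path that starts at `u` and is labelled by `w`. -/
def pathSum (a : ↥X → G → ℤ) (b : Λ → G → ℤ) (w : RelFree H X) (u : G) : ℤ :=
  ((crossedHom a b w).left u).toAdd

variable (a : ↥X → G → ℤ) (b : Λ → G → ℤ)

lemma crossedHom_right (w : RelFree H X) : (crossedHom a b w).right = relEps H X w := by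
  have : SemidirectProduct.rightHom.comp (crossedHom a b) = relEps H X := by
    apply Monoid.Coprod.hom_ext
    · apply Monoid.CoprodI.ext_hom
      intro l
      ext h
      simp [crossedHom, relEps]
    · apply FreeGroup.ext_hom
      intro x
      simp [crossedHom, relEps]
  exact DFunLike.congr_fun this w

lemma pathSum_mul (v w : RelFree H X) (u : G) :
    pathSum a b (v * w) u = pathSum a b v u + pathSum a b w (u * relEps H X v) := by
  rw [pathSum, map_mul, ← crossedHom_right a b]
  rfl

@[simp]
lemma pathSum_one (u : G) : pathSum (H := H) a b 1 u = 0 := by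
  simp [pathSum]

lemma pathSum_inv (w : RelFree H X) (u : G) :
    pathSum a b w⁻¹ u = -pathSum a b w (u * (relEps H X w)⁻¹) := by
  have h := pathSum_mul a b w⁻¹ w u
  simp only [inv_mul_cancel, pathSum_one, map_inv] at h
  linarith

lemma pathSum_conj {r : RelFree H X} (hr : relEps H X r = 1) (c : RelFree H X) (u : G) :
    pathSum a b (c⁻¹ * r * c) u = pathSum a b r (u * (relEps H X c)⁻¹) := by
  simp [pathSum_mul, pathSum_inv, hr]

lemma pathSum_conj_prod {k : ℕ} {r c : Fin k → RelFree H X} (hr : ∀ i, relEps H X (r i) = 1)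
    (u : G) :
    pathSum a b (List.ofFn fun i => (c i)⁻¹ * r i * c i).prod u =
      ∑ i, pathSum a b (r i) (u * (relEps H X (c i))⁻¹) := by
  induction k with
  | zero => simp
  | succ k ih =>
    rw [List.ofFn_succ, List.prod_cons, pathSum_mul, pathSum_conj a b (hr 0), Fin.sum_univ_succ,
      ← ih fun i => hr i.succ]
    congr 2
    simp [hr]

/-- If every member of a finite family of crossed homomorphisms is nonzero on `w`, while each
relator is detected by at most `M` members at each base point, then a decomposition of `w` as a
product of `k` conjugates of relators bounds the size of the family by `k * M`. -/
lemma card_le_of_pathSum_ne_zero {ι : Type*} (J : Finset ι) (a : ι → ↥X → G → ℤ)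
    (b : ι → Λ → G → ℤ) {R : Set (RelFree H X)} (hR : ∀ r ∈ R, relEps H X r = 1) {M k : ℕ}
    (hM : ∀ r ∈ R, ∀ g, ∃ B : Finset ι, B.card ≤ M ∧
      ∀ j ∈ J, pathSum (a j) (b j) r g ≠ 0 → j ∈ B)
    {r c : Fin k → RelFree H X} (hr : ∀ i, r i ∈ R) (u : G)
    (hne : ∀ j ∈ J,
      pathSum (a j) (b j) (List.ofFn fun i => (c i)⁻¹ * r i * c i).prod u ≠ 0) :
    J.card ≤ k * M := by
  classical
  choose B hBc hB using fun i => hM (r i) (hr i) (u * (relEps H X (c i))⁻¹)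
  calc J.card ≤ (Finset.univ.biUnion B).card := by
        apply Finset.card_le_card
        intro j hj
        have h := hne j hj
        rw [pathSum_conj_prod _ _ fun i => hR _ (hr i)] at h
        obtain ⟨i, -, hi⟩ := Finset.exists_ne_zero_of_sum_ne_zero h
        exact Finset.mem_biUnion.2 ⟨i, Finset.mem_univ i, hB i j hj hi⟩
    _ ≤ ∑ i, (B i).card := Finset.card_biUnion_le
    _ ≤ ∑ _i : Fin k, M := Finset.sum_le_sum fun i _ => hBc i
    _ = k * M := by simp

end CrossedHom

section Words

variable {G : Type*} [Group G] {Λ : Type*} {H : Λ → Subgroup G} {X : Set G}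

/-- The element of `G` represented by a word. -/
def wordVal (w : List (RelLetter H X)) : G := (w.map RelLetter.val).prod

@[simp]
lemma wordVal_nil : wordVal ([] : List (RelLetter H X)) = 1 := rfl

@[simp]
lemma wordVal_cons (x : RelLetter H X) (w : List (RelLetter H X)) :
    wordVal (x :: w) = x.val * wordVal w := by simp [wordVal]

@[simp]
lemma wordVal_append (v w : List (RelLetter H X)) :
    wordVal (v ++ w) = wordVal v * wordVal w := by simp [wordVal]

@[simp]
lemma wordToF_nil : wordToF ([] : List (RelLetter H X)) = 1 := rfl

@[simp]
lemma wordToF_cons (x : RelLetter H X) (w : List (RelLetter H X)) :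
    wordToF (x :: w) = x.toF * wordToF w := by simp [wordToF]

@[simp]
lemma wordToF_append (v w : List (RelLetter H X)) :
    wordToF (v ++ w) = wordToF v * wordToF w := by simp [wordToF]

@[simp]
lemma relEps_toF (x : RelLetter H X) : relEps H X x.toF = x.val := by
  rcases x with ⟨l, h⟩ | ⟨x, _ | _⟩ <;> simp [relEps, RelLetter.toF, RelLetter.val]

@[simp]
lemma relEps_wordToF (w : List (RelLetter H X)) : relEps H X (wordToF w) = wordVal w := by
  induction w with
  | nil => simp
  | cons x w ih => simp [ih]

/-- The formal inverse of a letter. -/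
def invLetter : RelLetter H X → RelLetter H X
  | Sum.inl ⟨l, h⟩ => Sum.inl ⟨l, ⟨h.1⁻¹, inv_ne_one.2 h.2⟩⟩
  | Sum.inr (x, b) => Sum.inr (x, !b)

@[simp]
lemma toF_invLetter (x : RelLetter H X) : (invLetter x).toF = x.toF⁻¹ := by
  rcases x with ⟨l, h⟩ | ⟨x, _ | _⟩ <;> simp [invLetter, RelLetter.toF]

/-- The formal inverse of a word. -/
def invWord (w : List (RelLetter H X)) : List (RelLetter H X) := (w.map invLetter).reverse

@[simp]
lemma length_invWord (w : List (RelLetter H X)) : (invWord w).length = w.length := by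
  simp [invWord]

@[simp]
lemma wordToF_invWord (w : List (RelLetter H X)) : wordToF (invWord w) = (wordToF w)⁻¹ := by
  induction w with
  | nil => simp [invWord]
  | cons x w ih =>
    have : invWord (x :: w) = invWord w ++ [invLetter x] := by simp [invWord]
    simp [this, ih]

@[simp]
lemma wordVal_invWord (w : List (RelLetter H X)) : wordVal (invWord w) = (wordVal w)⁻¹ := by
  rw [← relEps_wordToF, wordToF_invWord, map_inv, relEps_wordToF]

lemma exists_wordToF_eq (r : RelFree H X) : ∃ w : List (RelLetter H X), wordToF w = r := by
  let S : Subgroup (RelFree H X) :=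
    { carrier := {r | ∃ w : List (RelLetter H X), wordToF w = r}
      one_mem' := ⟨[], rfl⟩
      mul_mem' := by
        rintro _ _ ⟨v, rfl⟩ ⟨w, rfl⟩
        exact ⟨v ++ w, wordToF_append v w⟩
      inv_mem' := by
        rintro _ ⟨w, rfl⟩
        exact ⟨invWord w, wordToF_invWord w⟩ }
  change r ∈ S
  induction r using Monoid.Coprod.induction_on with
  | inl m =>
    induction m using Monoid.CoprodI.induction_on with
    | one => rw [map_one]; exact S.one_mem
    | of l h =>
      by_cases hh : h = 1
      · subst hh
        rw [map_one, map_one]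
        exact S.one_mem
      · exact ⟨[Sum.inl ⟨l, ⟨h, hh⟩⟩], by simp [RelLetter.toF]⟩
    | mul x y hx hy => rw [map_mul]; exact S.mul_mem hx hy
  | inr n =>
    have hof : ∀ x : ↥X, Monoid.Coprod.inr (FreeGroup.of x) ∈ S :=
      fun x => ⟨[Sum.inr (x, true)], by simp [RelLetter.toF]⟩
    induction n using FreeGroup.induction_on with
    | C1 => rw [map_one]; exact S.one_mem
    | of x => exact hof x
    | inv_of x _ => rw [map_inv]; exact S.inv_mem (hof x)
    | mul x y hx hy => rw [map_mul]; exact S.mul_mem hx hy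
  | mul x y hx hy => exact S.mul_mem hx hy

lemma pathSum_wordToF (a : ↥X → G → ℤ) (b : Λ → G → ℤ) (w : List (RelLetter H X)) (u : G) :
    pathSum a b (wordToF w) u =
      ∑ i : Fin w.length, pathSum a b (w[i]).toF (u * wordVal (w.take i)) := by
  induction w generalizing u with
  | nil => simp
  | cons x w ih =>
    rw [wordToF_cons, pathSum_mul, ih, relEps_toF]
    simp only [List.length_cons]
    rw [Fin.sum_univ_succ]
    simp [mul_assoc]

lemma pathSum_letter (a : ↥X → G → ℤ) (b : Λ → G → ℤ) (x : RelLetter H X) (u : G) :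
    pathSum a b x.toF u = match x with
      | Sum.inl ⟨l, h⟩ => b l (u * h.1) - b l u
      | Sum.inr (x, true) => a x u
      | Sum.inr (x, false) => - a x (u * (x : G)⁻¹) := by
  rcases x with ⟨l, h⟩ | ⟨x, _ | _⟩
  · simp [pathSum, crossedHom, RelLetter.toF]
  · simp only [RelLetter.toF, Bool.false_eq_true, if_false, map_inv, pathSum_inv]
    simp [pathSum, crossedHom, relEps]
  · simp [pathSum, crossedHom, RelLetter.toF]

lemma wordVal_take_succ (w : List (RelLetter H X)) {i : ℕ} (hi : i < w.length) :
    wordVal (w.take (i + 1)) = wordVal (w.take i) * (w[i]).val := by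
  rw [List.take_succ_eq_append_getElem hi, wordVal_append]
  simp

end Words

end RelHyp

namespace RelHyp

section Length

variable {G : Type*} [Group G] {Λ : Type*} {H : Λ → Subgroup G} {X : Set G}

variable (H X) in
/-- The length of a shortest word in the letters of `X ∪ 𝓗` representing `g`. -/
noncomputable def letterLen (g : G) : ℕ :=
  sInf {n | ∃ w : List (RelLetter H X), w.length = n ∧ wordVal w = g}

variable (H X) in
/-- Every element of `G` is represented by a word over `X ∪ 𝓗`. -/
def RelGenerates : Prop := ∀ g : G, ∃ w : List (RelLetter H X), wordVal w = g

lemma letterLen_wordVal_le (w : List (RelLetter H X)) : letterLen H X (wordVal w) ≤ w.length :=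
  Nat.sInf_le ⟨w, rfl, rfl⟩

lemma exists_geodesic_word (hgen : RelGenerates H X) (g : G) :
    ∃ w : List (RelLetter H X), w.length = letterLen H X g ∧ wordVal w = g := by
  obtain ⟨w, hw⟩ := hgen g
  exact Nat.sInf_mem (s := {n | ∃ w : List (RelLetter H X), w.length = n ∧ wordVal w = g})
    ⟨_, w, rfl, hw⟩

lemma letterLen_mul_le (hgen : RelGenerates H X) (g h : G) :
    letterLen H X (g * h) ≤ letterLen H X g + letterLen H X h := by
  obtain ⟨v, hv, rfl⟩ := exists_geodesic_word hgen g
  obtain ⟨w, hw, rfl⟩ := exists_geodesic_word hgen h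
  rw [← hv, ← hw, ← wordVal_append, ← List.length_append]
  exact letterLen_wordVal_le _

lemma letterLen_inv_le (hgen : RelGenerates H X) (g : G) :
    letterLen H X g⁻¹ ≤ letterLen H X g := by
  obtain ⟨v, hv, rfl⟩ := exists_geodesic_word hgen g
  rw [← hv, ← wordVal_invWord, ← length_invWord]
  exact letterLen_wordVal_le _

lemma letterLen_val_le (x : RelLetter H X) : letterLen H X x.val ≤ 1 := by
  simpa using letterLen_wordVal_le [x]

lemma letterLen_le_one_of_mem {l : Λ} {h : G} (hh : h ∈ H l) : letterLen H X h ≤ 1 := by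
  by_cases h1 : h = 1
  · subst h1
    exact (letterLen_wordVal_le (H := H) (X := X) []).trans zero_le_one
  · exact letterLen_val_le (Sum.inl ⟨l, ⟨⟨h, hh⟩, fun h' => h1 (by simpa using h')⟩⟩)

lemma val_mem_of_hIndex {x : RelLetter H X} {l : Λ} (hx : x.hIndex = some l) : x.val ∈ H l := by
  rcases x with ⟨l', h⟩ | x
  · simp only [RelLetter.hIndex, Option.some.injEq] at hx
    subst hx
    exact h.1.2
  · simp [RelLetter.hIndex] at hx

/-- A geodesic word has at most one letter in each coset of each `H l`. -/
lemma eq_of_geodesic (hgen : RelGenerates H X) {w : List (RelLetter H X)}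
    (hw : w.length = letterLen H X (wordVal w)) {l : Λ} {i j : ℕ} (hi : i < w.length)
    (hj : j < w.length) (hil : (w[i]).hIndex = some l) (hjl : (w[j]).hIndex = some l)
    (h : (wordVal (w.take i))⁻¹ * wordVal (w.take j) ∈ H l) : i = j := by
  wlog hij : i < j generalizing i j
  · rcases (not_lt.1 hij).lt_or_eq with h' | h'
    · refine (this hj hi hjl hil ?_ h').symm
      simpa using (H l).inv_mem h
    · exact h'.symm
  have h2 : (wordVal (w.take i))⁻¹ * wordVal (w.take (j + 1)) ∈ H l := by
    rw [wordVal_take_succ w hj, ← mul_assoc]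
    exact (H l).mul_mem h (val_mem_of_hIndex hjl)
  have h3 : wordVal w = wordVal (w.take i) * ((wordVal (w.take i))⁻¹ * wordVal (w.take (j + 1))) *
      wordVal (w.drop (j + 1)) := by
    rw [mul_inv_cancel_left, ← wordVal_append, List.take_append_drop]
  have h4 := letterLen_mul_le hgen
    (wordVal (w.take i) * ((wordVal (w.take i))⁻¹ * wordVal (w.take (j + 1))))
    (wordVal (w.drop (j + 1)))
  have h5 := letterLen_mul_le hgen (wordVal (w.take i))
    ((wordVal (w.take i))⁻¹ * wordVal (w.take (j + 1)))
  have h6 := letterLen_wordVal_le (w.take i)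
  have h7 := letterLen_wordVal_le (w.drop (j + 1))
  have h8 := letterLen_le_one_of_mem (X := X) h2
  rw [← h3, ← hw] at h4
  simp only [List.length_take, List.length_drop] at h6 h7
  omega

end Length

section Isolated

variable {G : Type*} [Group G] {Λ : Type*} {H : Λ → Subgroup G} {X : Set G}

open scoped Classical in
/-- The potential that is the indicator function of `S` on the cosets of `H l`. -/
noncomputable def cosetInd (l : Λ) (S : Set G) (l' : Λ) (y : G) : ℤ :=
  if l' = l ∧ y ∈ S then 1 else 0

lemma of_pathSum_cosetInd_letter {l : Λ} {S : Set G} {x : RelLetter H X} {u : G}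
    (h : pathSum 0 (cosetInd l S) x.toF u ≠ 0) :
    x.hIndex = some l ∧ ¬(u ∈ S ↔ u * x.val ∈ S) := by
  rw [pathSum_letter] at h
  rcases x with ⟨l', h'⟩ | ⟨x, _ | _⟩
  · by_cases hl : l' = l
    · subst hl
      refine ⟨rfl, fun hu => h ?_⟩
      simp only [RelLetter.val] at hu
      by_cases h1 : u ∈ S
      · have h2 := hu.1 h1
        simp [cosetInd, h1, h2]
      · have h2 := mt hu.2 h1
        simp [cosetInd, h1, h2]
    · simp [cosetInd, hl] at h
  · simp at h
  · simp at h

lemma exists_of_pathSum_cosetInd {l : Λ} {S : Set G} {v : G} (hS : ∀ y ∈ S, v⁻¹ * y ∈ H l)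
    {w : List (RelLetter H X)} {u : G} (h : pathSum 0 (cosetInd l S) (wordToF w) u ≠ 0) :
    ∃ (i : ℕ) (hi : i < w.length), (w[i]).hIndex = some l ∧
      v⁻¹ * (u * wordVal (w.take i)) ∈ H l ∧ v⁻¹ * (u * wordVal (w.take (i + 1))) ∈ H l := by
  rw [pathSum_wordToF] at h
  obtain ⟨⟨i, hi⟩, -, h⟩ := Finset.exists_ne_zero_of_sum_ne_zero h
  replace h : pathSum 0 (cosetInd l S) (w[i]).toF (u * wordVal (w.take i)) ≠ 0 := h
  obtain ⟨hl, h⟩ := of_pathSum_cosetInd_letter h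
  have hx := val_mem_of_hIndex hl
  refine ⟨i, hi, hl, ?_⟩
  rw [wordVal_take_succ w hi, ← mul_assoc, ← mul_assoc, ← mul_assoc]
  rw [(H l).mul_mem_cancel_right hx, and_self]
  by_cases hu : u * wordVal (w.take i) ∈ S
  · simpa [mul_assoc] using hS _ hu
  · have := hS (u * wordVal (w.take i) * (w[i]).val) (by tauto)
    rw [← (H l).mul_mem_cancel_right hx]
    simpa [mul_assoc] using this

/-- Along a geodesic word, only one letter contributes to the sum detecting a coset. -/
lemma pathSum_cosetInd_geodesic (hgen : RelGenerates H X) {w : List (RelLetter H X)}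
    (hw : w.length = letterLen H X (wordVal w)) {l : Λ} {i : ℕ} (hi : i < w.length)
    (hl : (w[i]).hIndex = some l) {u : G} {S : Set G}
    (hS : ∀ y ∈ S, (u * wordVal (w.take i))⁻¹ * y ∈ H l) (h1 : u * wordVal (w.take i) ∈ S)
    (h2 : u * wordVal (w.take i) * (w[i]).val ∉ S) :
    pathSum 0 (cosetInd l S) (wordToF w) u ≠ 0 := by
  rw [pathSum_wordToF, Finset.sum_eq_single ⟨i, hi⟩]
  · rw [pathSum_letter]
    obtain ⟨l', h, hx⟩ : ∃ l' h, w[i] = Sum.inl ⟨l', h⟩ := by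
      rcases hx : w[i] with ⟨l', h⟩ | x
      · exact ⟨l', h, rfl⟩
      · rw [hx] at hl
        simp [RelLetter.hIndex] at hl
    rw [hx] at hl h2
    simp only [RelLetter.hIndex, Option.some.injEq] at hl
    subst hl
    simp only [Fin.getElem_fin, hx]
    simp only [RelLetter.val] at h2
    simp [cosetInd, h1, h2]
  · rintro ⟨j, hj⟩ - hji
    by_contra h
    replace h : pathSum 0 (cosetInd l S) (w[j]).toF (u * wordVal (w.take j)) ≠ 0 := h
    obtain ⟨hjl, h⟩ := of_pathSum_cosetInd_letter h
    refine hji (Fin.ext (eq_of_geodesic hgen hw hi hj hl hjl ?_).symm)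
    have hx := val_mem_of_hIndex hjl
    by_cases hu : u * wordVal (w.take j) ∈ S
    · simpa [mul_assoc] using hS _ hu
    · have := hS (u * wordVal (w.take j) * (w[j]).val) (by tauto)
      rw [← (H l).mul_mem_cancel_right hx]
      simpa [mul_assoc] using this
  · simp

/-- The data of a relative presentation with a linear isoperimetric function, with bounds on the
relators. -/
structure LinearPres (H : Λ → Subgroup G) (X : Set G) (R : Set (RelFree H X)) (Ω : Set G)
    (A B L : ℕ) : Prop where
  gen : RelGenerates H X
  area : IsIsoperFn H X R fun n => A * n + B
  ker : ∀ r ∈ R, relEps H X r = 1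
  rel : ∀ r ∈ R, ∃ w : List (RelLetter H X), wordToF w = r ∧ w.length ≤ L ∧
    ∀ x ∈ w, x.val ∈ Ω ∧ x.val⁻¹ ∈ Ω

variable {R : Set (RelFree H X)} {Ω : Set G} {A B L : ℕ}

lemma LinearPres.card_le (hP : LinearPres H X R Ω A B L) {ι : Type*} (J : Finset ι)
    (a : ι → ↥X → G → ℤ) (b : ι → Λ → G → ℤ) {M : ℕ}
    (hM : ∀ w : List (RelLetter H X), w.length ≤ L → (∀ x ∈ w, x.val ∈ Ω ∧ x.val⁻¹ ∈ Ω) →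
      wordVal w = 1 → ∀ g, ∃ B : Finset ι, B.card ≤ M ∧
      ∀ j ∈ J, pathSum (a j) (b j) (wordToF w) g ≠ 0 → j ∈ B)
    {w : List (RelLetter H X)} (hw : wordVal w = 1) (u : G)
    (hne : ∀ j ∈ J, pathSum (a j) (b j) (wordToF w) u ≠ 0) :
    J.card ≤ (A * w.length + B) * M := by
  obtain ⟨k, hk, r, c, hr, hrc⟩ := hP.area w (by rw [relEps_wordToF, hw])
  rw [hrc] at hne
  refine (card_le_of_pathSum_ne_zero J a b hP.ker ?_ hr u hne).trans (Nat.mul_le_mul_right _ hk)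
  intro r hr g
  obtain ⟨v, rfl, hv, hvΩ⟩ := hP.rel r hr
  exact hM v hv hvΩ (by rw [← relEps_wordToF, hP.ker _ hr]) g

open scoped Pointwise in
/-- An isolated edge of a closed path has bounded length in the finite set `Ω`. -/
lemma LinearPres.mem_pow (hP : LinearPres H X R Ω A B L) {w : List (RelLetter H X)}
    (hw : wordVal w = 1) (u v h : G) (l : Λ)
    (hne : ∀ S : Set G, (∀ y ∈ S, v⁻¹ * y ∈ H l) → v ∈ S → v * h ∉ S →
      pathSum 0 (cosetInd l S) (wordToF w) u ≠ 0) :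
    h ∈ (insert 1 Ω) ^ ((A * w.length + B) * L) := by
  classical
  by_contra hh
  set N := (A * w.length + B) * L with hN
  let S : ℕ → Set G := fun m => {y | v⁻¹ * y ∈ H l ∧ v⁻¹ * y ∈ (insert 1 Ω) ^ m}
  have hmono : ∀ {m m' : ℕ}, m ≤ m' → (insert 1 Ω : Set G) ^ m ⊆ (insert 1 Ω) ^ m' :=
    fun h => Set.pow_subset_pow_right (Set.mem_insert _ _) h
  have hstep : ∀ {m m' : ℕ} {y z : G}, m < m' → y ∈ S m → z ∈ H l → z ∈ Ω → y * z ∈ S m' := by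
    intro m m' y z hm hy hz hzΩ
    refine ⟨by simpa [mul_assoc] using (H l).mul_mem hy.1 hz, hmono hm ?_⟩
    rw [← mul_assoc, pow_succ]
    exact Set.mul_mem_mul hy.2 (Set.mem_insert_of_mem _ hzΩ)
  have key : (Finset.range (N + 1)).card ≤ N := by
    refine hP.card_le (Finset.range (N + 1)) (fun _ => 0) (fun m => cosetInd l (S m)) ?_ hw u ?_
    · intro r hrL hrΩ _ g
      let E : Fin r.length → Finset ℕ := fun i => (Finset.range (N + 1)).filter fun m =>
        pathSum 0 (cosetInd l (S m)) (r[i]).toF (g * wordVal (r.take i)) ≠ 0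
      refine ⟨Finset.univ.biUnion E, ?_, ?_⟩
      · refine (Finset.card_biUnion_le_card_mul _ _ 1 fun i _ => ?_).trans (by simpa using hrL)
        refine Finset.card_le_one.2 fun m hm m' hm' => ?_
        have hx := hrΩ r[i] (List.getElem_mem _)
        by_contra hmm
        wlog hlt : m < m' generalizing m m'
        · exact this m' hm' m hm (Ne.symm hmm) (by omega)
        obtain ⟨hl, h1⟩ := of_pathSum_cosetInd_letter (Finset.mem_filter.1 hm).2
        obtain ⟨-, h2⟩ := of_pathSum_cosetInd_letter (Finset.mem_filter.1 hm').2
        generalize g * wordVal (r.take i) = y at h1 h2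
        have hxl := val_mem_of_hIndex hl
        have hsub : S m ⊆ S m' := fun y hy => ⟨hy.1, hmono hlt.le hy.2⟩
        by_cases hy : y ∈ S m
        · exact h2 ⟨fun _ => hstep hlt hy hxl hx.1, fun _ => hsub hy⟩
        · have hy' : y * (r[i]).val ∈ S m := by tauto
          refine h2 ⟨fun _ => hsub hy', fun _ => ?_⟩
          simpa using hstep hlt hy' ((H l).inv_mem hxl) hx.2
      · intro m hm hne
        rw [pathSum_wordToF] at hne
        obtain ⟨i, -, hi⟩ := Finset.exists_ne_zero_of_sum_ne_zero hne
        exact Finset.mem_biUnion.2 ⟨i, Finset.mem_univ i, Finset.mem_filter.2 ⟨hm, hi⟩⟩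
    · intro m hm
      refine hne _ (fun y hy => hy.1) ?_ ?_
      · exact ⟨by simp, hmono (Nat.zero_le m) (by simp)⟩
      · rintro ⟨-, h2⟩
        rw [inv_mul_cancel_left] at h2
        exact hh (hmono (Nat.lt_succ_iff.1 (Finset.mem_range.1 hm)) h2)
  simp at key

/-- The value of a path sum around a quadrilateral. -/
lemma pathSum_quad (a : ↥X → G → ℤ) (b : Λ → G → ℤ) {U T T' V : List (RelLetter H X)}
    (h : wordVal U * wordVal T = wordVal T' * wordVal V) (u : G) :
    pathSum a b (wordToF (U ++ T ++ invWord V ++ invWord T')) u =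
      pathSum a b (wordToF U) u + pathSum a b (wordToF T) (u * wordVal U) -
        pathSum a b (wordToF V) (u * wordVal T') - pathSum a b (wordToF T') u := by
  simp only [wordToF_append, wordToF_invWord, pathSum_mul, pathSum_inv, map_mul, map_inv,
    relEps_wordToF, h]
  simp [mul_assoc, sub_eq_add_neg]

lemma wordVal_quad {U T T' V : List (RelLetter H X)}
    (h : wordVal U * wordVal T = wordVal T' * wordVal V) :
    wordVal (U ++ T ++ invWord V ++ invWord T') = 1 := by
  simp only [wordVal_append, wordVal_invWord, h]
  group

end Isolated

end RelHyp

namespace RelHyp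

section Level

variable {G : Type*} [Group G] {Λ : Type*} {H : Λ → Subgroup G} {X : Set G}

variable (H X) in
/-- The least length of an element conjugating `f` to `x⁻¹ * f * x`. -/
noncomputable def conjLevel (f x : G) : ℕ :=
  sInf {n | ∃ s : G, letterLen H X s = n ∧ s⁻¹ * f * s = x⁻¹ * f * x}

lemma exists_conjLevel (f x : G) :
    ∃ s : G, letterLen H X s = conjLevel H X f x ∧ s⁻¹ * f * s = x⁻¹ * f * x :=
  Nat.sInf_mem (s := {n | ∃ s : G, letterLen H X s = n ∧ s⁻¹ * f * s = x⁻¹ * f * x})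
    ⟨_, x, rfl, rfl⟩

lemma conjLevel_le {f x s : G} (h : s⁻¹ * f * s = x⁻¹ * f * x) :
    conjLevel H X f x ≤ letterLen H X s := Nat.sInf_le ⟨s, rfl, h⟩

lemma conjLevel_congr {f x y : G} (h : x⁻¹ * f * x = y⁻¹ * f * y) :
    conjLevel H X f x = conjLevel H X f y := by
  rw [conjLevel, h, conjLevel]

lemma conjLevel_mul_left (f x : G) : conjLevel H X f (f * x) = conjLevel H X f x :=
  conjLevel_congr (by group)

lemma conjLevel_mul_le (hgen : RelGenerates H X) (f x y : G) :
    conjLevel H X f (x * y) ≤ conjLevel H X f x + letterLen H X y := by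
  obtain ⟨s, hs, h⟩ := exists_conjLevel (H := H) (X := X) f x
  rw [← hs]
  refine (conjLevel_le (s := s * y) ?_).trans (letterLen_mul_le hgen s y)
  calc (s * y)⁻¹ * f * (s * y) = y⁻¹ * (s⁻¹ * f * s) * y := by group
    _ = (x * y)⁻¹ * f * (x * y) := by rw [h]; group

lemma conjLevel_le_mul (hgen : RelGenerates H X) (f x y : G) :
    conjLevel H X f x ≤ conjLevel H X f (x * y) + letterLen H X y := by
  have h := conjLevel_mul_le hgen f (x * y) y⁻¹
  have h' := letterLen_inv_le hgen y
  rw [mul_inv_cancel_right] at h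
  omega

lemma conjLevel_one (f : G) : conjLevel H X f 1 = 0 := by
  have h := conjLevel_le (H := H) (X := X) (f := f) (x := 1) (s := 1) rfl
  have h' : letterLen H X 1 ≤ 0 := letterLen_wordVal_le (H := H) (X := X) []
  omega

lemma letterLen_wordVal_take_le (w : List (RelLetter H X)) (i : ℕ) :
    letterLen H X (wordVal (w.take i)) ≤ i :=
  (letterLen_wordVal_le _).trans (by simp)

/-- Levels grow at unit speed along a word that realizes the level of its endpoint. -/
lemma conjLevel_take (hgen : RelGenerates H X) {f : G} {w : List (RelLetter H X)}
    (hw : conjLevel H X f (wordVal w) = w.length) {j : ℕ} (hj : j ≤ w.length) :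
    conjLevel H X f (wordVal (w.take j)) = j := by
  have h1 := conjLevel_mul_le hgen f 1 (wordVal (w.take j))
  have h2 := letterLen_wordVal_take_le w j
  have h3 := conjLevel_mul_le hgen f (wordVal (w.take j)) (wordVal (w.drop j))
  have h4 := letterLen_wordVal_le (w.drop j)
  rw [← wordVal_append, List.take_append_drop, hw] at h3
  rw [one_mul, conjLevel_one] at h1
  rw [List.length_drop] at h4
  omega

variable (H X) in
open scoped Classical in
/-- The values on `X`-edges of the crossed homomorphism localizing the coboundary of `s` to the
ball of radius `r` around `p`. -/
noncomputable def ballEdge (s : G → ℤ) (p : G) (r : ℕ) (x : ↥X) (u : G) : ℤ :=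
  if letterLen H X (p⁻¹ * u) ≤ r then s (u * x) - s u else 0

variable (H X) in
open scoped Classical in
/-- The potential on cosets of the crossed homomorphism localizing the coboundary of `s` to the
ball of radius `r` around `p`. -/
noncomputable def ballPot (s : G → ℤ) (p : G) (r : ℕ) (l : Λ) (v : G) : ℤ :=
  if ∃ h ∈ H l, letterLen H X (p⁻¹ * (v * h)) ≤ r then s v else 0

lemma pathSum_ball_letter (hgen : RelGenerates H X) (s : G → ℤ) (p : G) (r : ℕ)
    (x : RelLetter H X) (u : G) :
    (pathSum (ballEdge H X s p r) (ballPot H X s p r) x.toF u = s (u * x.val) - s u ∧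
        letterLen H X (p⁻¹ * u) ≤ r + 1) ∨
      (pathSum (ballEdge H X s p r) (ballPot H X s p r) x.toF u = 0 ∧
        r < letterLen H X (p⁻¹ * u) + 1) := by
  rw [pathSum_letter]
  rcases x with ⟨l, h⟩ | ⟨x, _ | _⟩
  · have hiff : (∃ y ∈ H l, letterLen H X (p⁻¹ * (u * h.1 * y)) ≤ r) ↔
        ∃ y ∈ H l, letterLen H X (p⁻¹ * (u * y)) ≤ r :=
      ⟨fun ⟨y, hy, hr⟩ => ⟨h.1 * y, (H l).mul_mem h.1.2 hy, by rwa [← mul_assoc u]⟩,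
        fun ⟨y, hy, hr⟩ => ⟨(h.1 : G)⁻¹ * y, (H l).mul_mem ((H l).inv_mem h.1.2) hy, by
          rwa [mul_assoc u, mul_inv_cancel_left]⟩⟩
    by_cases hc : ∃ y ∈ H l, letterLen H X (p⁻¹ * (u * y)) ≤ r
    · refine Or.inl ⟨?_, ?_⟩
      · simp only [ballPot]
        rw [if_pos hc, if_pos (hiff.2 hc)]
        rfl
      · obtain ⟨y, hy, hr⟩ := hc
        have h1 := letterLen_mul_le hgen (p⁻¹ * (u * y)) y⁻¹
        have h2 := letterLen_le_one_of_mem (X := X) ((H l).inv_mem hy)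
        rw [mul_assoc, mul_inv_cancel_right] at h1
        omega
    · refine Or.inr ⟨?_, ?_⟩
      · simp only [ballPot]
        rw [if_neg hc, if_neg (mt hiff.1 hc), sub_zero]
      · have : ¬letterLen H X (p⁻¹ * u) ≤ r := fun h' => hc ⟨1, (H l).one_mem, by rwa [mul_one]⟩
        omega
  · have h1 := letterLen_val_le (H := H) (Sum.inr (x, false))
    have h2 := letterLen_mul_le hgen (p⁻¹ * u) (x : G)⁻¹
    have h3 := letterLen_mul_le hgen (p⁻¹ * (u * (x : G)⁻¹)) x
    have h4 := letterLen_val_le (H := H) (Sum.inr (x, true))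
    simp only [RelLetter.val, Bool.false_eq_true, if_false, if_true] at h1 h4 ⊢
    rw [mul_assoc, inv_mul_cancel_right] at h3
    rw [mul_assoc] at h2
    by_cases hc : letterLen H X (p⁻¹ * (u * (x : G)⁻¹)) ≤ r
    · refine Or.inl ⟨?_, by omega⟩
      simp [ballEdge, hc]
    · refine Or.inr ⟨?_, by omega⟩
      simp [ballEdge, hc]
  · simp only [RelLetter.val, if_true]
    by_cases hc : letterLen H X (p⁻¹ * u) ≤ r
    · refine Or.inl ⟨?_, by omega⟩
      simp [ballEdge, hc]
    · refine Or.inr ⟨?_, by omega⟩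
      simp [ballEdge, hc]

lemma pathSum_ball_of_eq (hgen : RelGenerates H X) {s : G → ℤ} {p : G} {r : ℕ}
    {x : RelLetter H X} {u : G} (h : s (u * x.val) = s u) :
    pathSum (ballEdge H X s p r) (ballPot H X s p r) x.toF u = 0 := by
  rcases pathSum_ball_letter hgen s p r x u with h' | h'
  · rw [h'.1, h, sub_self]
  · exact h'.1

lemma pathSum_ball_of_const (hgen : RelGenerates H X) {s : G → ℤ} {p : G} {r : ℕ}
    {w : List (RelLetter H X)} {u : G} (c : ℤ)
    (h : ∀ i ≤ w.length, s (u * wordVal (w.take i)) = c) :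
    pathSum (ballEdge H X s p r) (ballPot H X s p r) (wordToF w) u = 0 := by
  rw [pathSum_wordToF]
  refine Finset.sum_eq_zero fun ⟨i, hi⟩ _ => pathSum_ball_of_eq hgen ?_
  change s (u * wordVal (w.take i) * (w[i]).val) = s (u * wordVal (w.take i))
  rw [mul_assoc, ← wordVal_take_succ w hi, h _ hi, h _ hi.le]

lemma sum_telescope (s : G → ℤ) (w : List (RelLetter H X)) (u : G) :
    ∑ i : Fin w.length, (s (u * wordVal (w.take i) * (w[i]).val) - s (u * wordVal (w.take i))) =
      s (u * wordVal w) - s u := by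
  have h := Finset.sum_range_sub (fun i => s (u * wordVal (w.take i))) w.length
  rw [← Fin.sum_univ_eq_sum_range
    (fun i => s (u * wordVal (w.take (i + 1))) - s (u * wordVal (w.take i)))] at h
  simp only [List.take_length, List.take_zero, wordVal_nil, mul_one] at h
  rw [← h]
  refine Finset.sum_congr rfl fun ⟨i, hi⟩ _ => ?_
  rw [wordVal_take_succ w hi, mul_assoc]
  rfl

/-- A short closed path detected by the localized coboundary is near the boundary of the ball. -/
lemma pathSum_ball_closed (hgen : RelGenerates H X) {s : G → ℤ} {p : G} {r L : ℕ}
    {w : List (RelLetter H X)} (hwL : w.length ≤ L) (hw : wordVal w = 1) {g : G}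
    (h : pathSum (ballEdge H X s p r) (ballPot H X s p r) (wordToF w) g ≠ 0) :
    letterLen H X (p⁻¹ * g) ≤ r + 1 + L ∧ r ≤ letterLen H X (p⁻¹ * g) + L := by
  have hd : ∀ i, letterLen H X (p⁻¹ * (g * wordVal (w.take i))) ≤ letterLen H X (p⁻¹ * g) + i ∧
      letterLen H X (p⁻¹ * g) ≤ letterLen H X (p⁻¹ * (g * wordVal (w.take i))) + i := by
    intro i
    have h0 := letterLen_wordVal_take_le w i
    have h1 := letterLen_mul_le hgen (p⁻¹ * g) (wordVal (w.take i))
    have h2 := letterLen_mul_le hgen (p⁻¹ * (g * wordVal (w.take i))) (wordVal (w.take i))⁻¹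
    have h3 := letterLen_inv_le hgen (wordVal (w.take i))
    rw [mul_assoc, mul_inv_cancel_right] at h2
    rw [mul_assoc] at h1
    omega
  rw [pathSum_wordToF] at h
  constructor
  · by_contra! hlt
    refine h (Finset.sum_eq_zero fun ⟨i, hi⟩ _ => ?_)
    rcases pathSum_ball_letter hgen s p r w[i] (g * wordVal (w.take i)) with h' | h'
    · have := (hd i).2
      omega
    · exact h'.1
  · by_contra! hlt
    apply h
    have h1 := sum_telescope s w g
    rw [hw, mul_one, sub_self] at h1
    rw [← h1]
    refine Finset.sum_congr rfl fun ⟨i, hi⟩ _ => ?_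
    rcases pathSum_ball_letter hgen s p r w[i] (g * wordVal (w.take i)) with h' | h'
    · exact h'.1
    · have := (hd i).1
      omega

variable (H X) in
open scoped Classical in
/-- The indicator function of the elements of level at least `j`. -/
noncomputable def levelInd (f : G) (j : ℕ) (y : G) : ℤ := if j ≤ conjLevel H X f y then 1 else 0

variable {R : Set (RelFree H X)} {Ω : Set G} {A B L : ℕ}

/-- The displacements of `f` along a shortest conjugator are bounded on average. -/
lemma LinearPres.sum_displacement_le (hP : LinearPres H X R Ω A B L) {f : G} {k : ℕ}
    {U V T : List (RelLetter H X)} (hU : wordVal U = f) (hUk : U.length ≤ k) (hVk : V.length ≤ k)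
    (hT : conjLevel H X f (wordVal T) = T.length)
    (hconj : wordVal U * wordVal T = wordVal T * wordVal V) :
    ∑ j ∈ Finset.Ioc k (T.length - k),
      (letterLen H X ((wordVal (T.take j))⁻¹ * f * wordVal (T.take j)) - 4) ≤
      (A * (2 * T.length + 2 * k) + B) * ((2 * L + 1) * (2 * L + 2)) := by
  classical
  have hgen := hP.gen
  set D : ℕ → ℕ := fun j => letterLen H X ((wordVal (T.take j))⁻¹ * f * wordVal (T.take j)) with hD
  let J : Finset (Σ _ : ℕ, ℕ) :=
    (Finset.Ioc k (T.length - k)).sigma fun j => Finset.Ico 2 (D j - 2)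
  have hJ : J.card = ∑ j ∈ Finset.Ioc k (T.length - k), (D j - 4) := by
    rw [Finset.card_sigma]
    refine Finset.sum_congr rfl fun j _ => ?_
    rw [Nat.card_Ico]
    omega
  rw [← hJ]
  refine (hP.card_le J (fun c => ballEdge H X (levelInd H X f c.1) (wordVal (T.take c.1)) c.2)
    (fun c => ballPot H X (levelInd H X f c.1) (wordVal (T.take c.1)) c.2)
    (M := (2 * L + 1) * (2 * L + 2)) ?_ (wordVal_quad hconj) 1 ?_).trans ?_
  · intro w hwL _ hw g
    refine ⟨(Finset.Icc (conjLevel H X f g - L) (conjLevel H X f g + L)).sigma fun j =>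
      Finset.Icc (letterLen H X ((wordVal (T.take j))⁻¹ * g) - (L + 1))
        (letterLen H X ((wordVal (T.take j))⁻¹ * g) + L), ?_, ?_⟩
    · rw [Finset.card_sigma]
      refine (Finset.sum_le_card_nsmul _ _ (2 * L + 2) fun j _ => ?_).trans ?_
      · rw [Nat.card_Icc]
        omega
      · rw [smul_eq_mul, Nat.card_Icc]
        exact Nat.mul_le_mul_right _ (by omega)
    · rintro ⟨j, r⟩ - hne
      dsimp only at hne
      have hr := pathSum_ball_closed hgen hwL hw hne
      simp only [Finset.mem_sigma, Finset.mem_Icc]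
      refine ⟨?_, by omega, by omega⟩
      have hlev : ∀ i ≤ w.length,
          conjLevel H X f (g * wordVal (w.take i)) ≤ conjLevel H X f g + L ∧
          conjLevel H X f g ≤ conjLevel H X f (g * wordVal (w.take i)) + L := by
        intro i hi
        have h0 := letterLen_wordVal_take_le w i
        have h1 := conjLevel_mul_le hgen f g (wordVal (w.take i))
        have h2 := conjLevel_le_mul hgen f g (wordVal (w.take i))
        omega
      constructor
      · by_contra! hlt
        refine hne (pathSum_ball_of_const hgen 1 fun i hi => ?_)
        have := hlev i hi
        exact if_pos (by omega)
      · by_contra! hlt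
        refine hne (pathSum_ball_of_const hgen 0 fun i hi => ?_)
        have := hlev i hi
        exact if_neg (by omega)
  · rintro ⟨j, r⟩ hjr
    simp only [J, Finset.mem_sigma, Finset.mem_Ioc, Finset.mem_Ico] at hjr
    obtain ⟨⟨hkj, hjn⟩, hr2, hrD⟩ := hjr
    obtain ⟨i, rfl⟩ : ∃ i, j = i + 1 := ⟨j - 1, by omega⟩
    have hi : i < T.length := by omega
    have hTu : ∀ q ≤ T.length, conjLevel H X f (wordVal (T.take q)) = q :=
      fun q hq => conjLevel_take hgen hT hq
    have hxi := letterLen_val_le T[i]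
    dsimp only
    set s := levelInd H X f (i + 1) with hs
    set P := wordVal (T.take (i + 1)) with hPdef
    have hPi : P = wordVal (T.take i) * (T[i]).val := wordVal_take_succ T hi
    have hU0 : pathSum (ballEdge H X s P r) (ballPot H X s P r) (wordToF U) 1 = 0 := by
      refine pathSum_ball_of_const hgen 0 fun q hq => if_neg ?_
      have h0 := letterLen_wordVal_take_le U q
      have h1 := conjLevel_mul_le hgen f 1 (wordVal (U.take q))
      rw [conjLevel_one] at h1
      omega
    have hV0 : pathSum (ballEdge H X s P r) (ballPot H X s P r) (wordToF V)
        (1 * wordVal T) = 0 := by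
      refine pathSum_ball_of_const hgen 1 fun q hq => if_pos ?_
      have h0 := letterLen_wordVal_take_le V q
      have h1 := conjLevel_le_mul hgen f (wordVal T) (wordVal (V.take q))
      rw [one_mul]
      omega
    have hne : ∀ q (hq : q < T.length), q ≠ i → ∀ u : G,
        (∀ y, conjLevel H X f (u * y) = conjLevel H X f y) →
        pathSum (ballEdge H X s P r) (ballPot H X s P r) (T[q]).toF
          (u * wordVal (T.take q)) = 0 := by
      intro q hq hqi u hu
      apply pathSum_ball_of_eq hgen
      rw [mul_assoc, ← wordVal_take_succ T hq]
      simp only [hs, levelInd, hu, hTu q hq.le, hTu (q + 1) hq]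
      congr 1
      exact propext (by omega)
    have hT1 : pathSum (ballEdge H X s P r) (ballPot H X s P r) (wordToF T) 1 = 1 := by
      rw [pathSum_wordToF, Finset.sum_eq_single ⟨i, hi⟩]
      · change pathSum _ _ (T[i]).toF (1 * wordVal (T.take i)) = 1
        rcases pathSum_ball_letter hgen s P r T[i] (1 * wordVal (T.take i)) with h | h
        · rw [h.1, one_mul, ← wordVal_take_succ T hi]
          simp [hs, levelInd, hTu i hi.le, hTu (i + 1) hi]
        · have h1 := letterLen_inv_le hgen (T[i]).val
          have h2 := h.2
          rw [hPi, one_mul, mul_inv_rev, inv_mul_cancel_right] at h2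
          omega
      · rintro ⟨q, hq⟩ - hqi
        exact hne q hq (fun h => hqi (Fin.ext h)) 1 (by simp)
      · simp
    have hTf : pathSum (ballEdge H X s P r) (ballPot H X s P r) (wordToF T)
        (1 * wordVal U) = 0 := by
      rw [pathSum_wordToF, one_mul, hU]
      refine Finset.sum_eq_zero fun ⟨q, hq⟩ _ => ?_
      by_cases hqi : q = i
      · subst hqi
        rcases pathSum_ball_letter hgen s P r T[q] (f * wordVal (T.take q)) with h | h
        · have h1 := letterLen_mul_le hgen (P⁻¹ * (f * wordVal (T.take q))) (T[q]).val
          have h2 := h.2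
          have h3 : P⁻¹ * (f * wordVal (T.take q)) * (T[q]).val = P⁻¹ * f * P := by
            rw [hPi]
            group
          have h4 : D (q + 1) = letterLen H X (P⁻¹ * f * P) := rfl
          rw [h3] at h1
          omega
        · exact h.1
      · exact hne q hq hqi f fun y => conjLevel_mul_left f y
    rw [pathSum_quad _ _ hconj, hU0, hV0, hT1, hTf]
    norm_num
  · refine Nat.mul_le_mul_right _ (Nat.add_le_add_right (Nat.mul_le_mul_left _ ?_) _)
    simp only [List.length_append, length_invWord]
    omega

end Level

end RelHyp

namespace RelHyp

section Confinement

variable {G : Type*} [Group G] {Λ : Type*} {H : Λ → Subgroup G} {X : Set G}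

lemma wordVal_take_add (w : List (RelLetter H X)) (i a : ℕ) :
    wordVal (w.take i) * wordVal ((w.drop i).take a) = wordVal (w.take (i + a)) := by
  rw [← wordVal_append, List.take_add]

lemma conjLevel_le_add_one (hgen : RelGenerates H X) (f : G) {v y z : G} {l : Λ}
    (hy : v⁻¹ * y ∈ H l) (hz : v⁻¹ * z ∈ H l) : conjLevel H X f z ≤ conjLevel H X f y + 1 := by
  have h : y⁻¹ * z ∈ H l := by
    have := (H l).mul_mem ((H l).inv_mem hy) hz
    simpa [mul_assoc] using this
  have h1 := conjLevel_mul_le hgen f y (y⁻¹ * z)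
  have h2 := letterLen_le_one_of_mem (X := X) h
  rw [mul_inv_cancel_left] at h1
  omega

/-- If a segment of a level-realizing path meets a coset, then so do two elements of consecutive
levels. -/
lemma exists_level_of_segment (hgen : RelGenerates H X) {f : G} {T : List (RelLetter H X)}
    (hT : conjLevel H X f (wordVal T) = T.length) {i j : ℕ} (hj : j ≤ T.length) {u v : G}
    (hu : ∀ y, conjLevel H X f (u * y) = conjLevel H X f y) {l : Λ} {S : Set G}
    (hS : ∀ y ∈ S, v⁻¹ * y ∈ H l)
    (h : pathSum 0 (cosetInd l S) (wordToF ((T.drop i).take (j - i)))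
      (u * wordVal (T.take i)) ≠ 0) :
    ∃ (a : ℕ) (y z : G), i ≤ a ∧ a < j ∧ conjLevel H X f y = a ∧ conjLevel H X f z = a + 1 ∧
      v⁻¹ * y ∈ H l ∧ v⁻¹ * z ∈ H l := by
  obtain ⟨q, hq, -, h1, h2⟩ := exists_of_pathSum_cosetInd hS h
  simp only [List.length_take, List.length_drop] at hq
  rw [List.take_take, mul_assoc, wordVal_take_add] at h1 h2
  refine ⟨i + q, _, _, by omega, by omega, ?_, ?_, h1, h2⟩
  · rw [hu, min_eq_left (by omega), conjLevel_take hgen hT (by omega)]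
  · rw [hu, min_eq_left (by omega), conjLevel_take hgen hT (by omega)]
    omega

/-- A short word based at a distant level does not meet the coset. -/
lemma pathSum_eq_zero_of_far (hgen : RelGenerates H X) {f : G} {W : List (RelLetter H X)}
    {p v : G} {l : Λ} {K : ℕ} (hW : W.length ≤ K)
    (hfar : conjLevel H X f v + K + 1 < conjLevel H X f p ∨
      conjLevel H X f p + K + 1 < conjLevel H X f v) {S : Set G}
    (hS : ∀ y ∈ S, v⁻¹ * y ∈ H l) : pathSum 0 (cosetInd l S) (wordToF W) p = 0 := by
  by_contra h
  obtain ⟨q, hq, -, h1, -⟩ := exists_of_pathSum_cosetInd hS h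
  have hv : v⁻¹ * v ∈ H l := by simp
  have h2 := conjLevel_le_add_one hgen f hv h1
  have h3 := conjLevel_le_add_one hgen f h1 hv
  have h4 := conjLevel_mul_le hgen f p (wordVal (W.take q))
  have h5 := conjLevel_le_mul hgen f p (wordVal (W.take q))
  have h6 := letterLen_wordVal_take_le W q
  omega

variable {R : Set (RelFree H X)} {Ω : Set G} {A B L : ℕ}

open scoped Pointwise in
/-- The displacement of `f` at a level lying well between two other levels of small displacement
is represented by a word whose letters come from a fixed finite set. -/
lemma LinearPres.letters_confined (hP : LinearPres H X R Ω A B L) {f : G}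
    {T : List (RelLetter H X)} (hT : conjLevel H X f (wordVal T) = T.length) {K E i₁ i i₂ : ℕ}
    (h₁ : i₁ + 2 * K + 1 < i) (h₂ : i + 2 * K + 1 < i₂) (hE : i₂ ≤ i₁ + E) (hi₂ : i₂ ≤ T.length)
    {W₁ W W₂ : List (RelLetter H X)} (hW₁K : W₁.length ≤ K) (hWK : W.length ≤ K)
    (hW₂K : W₂.length ≤ K)
    (hW₁ : wordVal W₁ = (wordVal (T.take i₁))⁻¹ * f * wordVal (T.take i₁))
    (hW : wordVal W = (wordVal (T.take i))⁻¹ * f * wordVal (T.take i))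
    (hW₂ : wordVal W₂ = (wordVal (T.take i₂))⁻¹ * f * wordVal (T.take i₂))
    (hgeod : W.length = letterLen H X (wordVal W)) {x : RelLetter H X} (hx : x ∈ W) :
    x.val ∈ (insert 1 Ω) ^ ((A * (2 * K + 2 * E) + B) * L) ∪ (X ∪ X⁻¹) := by
  have hgen := hP.gen
  rcases hxl : x.hIndex with _ | l
  · right
    rcases x with ⟨l, h⟩ | ⟨x, _ | _⟩
    · simp [RelLetter.hIndex] at hxl
    · simp [RelLetter.val]
    · simp [RelLetter.val]
  left
  obtain ⟨q, hq, rfl⟩ := List.getElem_of_mem hx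
  set v := wordVal (T.take i) * wordVal (W.take q) with hv
  have hpow : ∀ {m : ℕ}, m ≤ 2 * K + 2 * E → (insert 1 Ω : Set G) ^ ((A * m + B) * L) ⊆
      (insert 1 Ω) ^ ((A * (2 * K + 2 * E) + B) * L) := fun hm =>
    Set.pow_subset_pow_right (Set.mem_insert _ _) (by gcongr)
  have hvl : conjLevel H X f v ≤ i + K ∧ i ≤ conjLevel H X f v + K := by
    have h3 := letterLen_wordVal_take_le W q
    have h4 := conjLevel_mul_le hgen f (wordVal (T.take i)) (wordVal (W.take q))
    have h5 := conjLevel_le_mul hgen f (wordVal (T.take i)) (wordVal (W.take q))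
    rw [conjLevel_take hgen hT (by omega), ← hv] at h4 h5
    omega
  have hseg : ∀ {a b : ℕ}, a ≤ b → b ≤ T.length →
      wordVal (T.take a) * wordVal ((T.drop a).take (b - a)) = wordVal (T.take b) := by
    intro a b hab _
    rw [wordVal_take_add, Nat.add_sub_cancel' hab]
  have hquad : ∀ {a b : ℕ} {U V : List (RelLetter H X)}, a ≤ b → b ≤ T.length →
      wordVal U = (wordVal (T.take a))⁻¹ * f * wordVal (T.take a) →
      wordVal V = (wordVal (T.take b))⁻¹ * f * wordVal (T.take b) →
      wordVal U * wordVal ((T.drop a).take (b - a)) =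
        wordVal ((T.drop a).take (b - a)) * wordVal V := by
    intro a b U V hab hb hU hV
    rw [hU, hV, ← hseg hab hb]
    group
  have hstart : ∀ {a : ℕ} {U : List (RelLetter H X)},
      wordVal U = (wordVal (T.take a))⁻¹ * f * wordVal (T.take a) →
      wordVal (T.take a) * wordVal U = f * wordVal (T.take a) := by
    intro a U hU
    rw [hU]
    group
  have hlevf := conjLevel_mul_left (H := H) (X := X) f
  have hlev1 : ∀ y, conjLevel H X f (1 * y) = conjLevel H X f y := by simp
  by_cases hbefore : ∃ u : G, (∀ y, conjLevel H X f (u * y) = conjLevel H X f y) ∧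
      ∃ S : Set G, (∀ y ∈ S, v⁻¹ * y ∈ H l) ∧ pathSum 0 (cosetInd l S)
        (wordToF ((T.drop i₁).take (i - i₁))) (u * wordVal (T.take i₁)) ≠ 0
  · obtain ⟨u, hu, S, hS, hne⟩ := hbefore
    obtain ⟨a, y, z, -, hai, hy, -, hyl, -⟩ :=
      exists_level_of_segment hgen hT (by omega) hu hS hne
    have hafter : ∀ u : G, (∀ y, conjLevel H X f (u * y) = conjLevel H X f y) →
        ∀ S : Set G, (∀ y ∈ S, v⁻¹ * y ∈ H l) → pathSum 0 (cosetInd l S)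
          (wordToF ((T.drop i).take (i₂ - i))) (u * wordVal (T.take i)) = 0 := by
      intro u hu S hS
      by_contra hne
      obtain ⟨b, y', z', hib, -, -, hz', -, hzl'⟩ :=
        exists_level_of_segment hgen hT hi₂ hu hS hne
      have := conjLevel_le_add_one hgen f hyl hzl'
      omega
    have hc := hquad (by omega) hi₂ hW hW₂
    refine hpow ?_ (hP.mem_pow (wordVal_quad hc) (wordVal (T.take i)) v _ l ?_)
    · simp only [List.length_append, length_invWord, List.length_take, List.length_drop]
      omega
    · intro S hS hvS hvS'
      have e1 := hafter f hlevf S hS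
      have e2 := hafter 1 hlev1 S hS
      rw [one_mul] at e2
      rw [pathSum_quad _ _ hc, hstart hW, hseg (by omega) hi₂, e1, e2,
        pathSum_eq_zero_of_far hgen (f := f) hW₂K _ hS, add_zero, sub_zero, sub_zero]
      · exact pathSum_cosetInd_geodesic hgen hgeod hq hxl hS hvS hvS'
      · rw [conjLevel_take hgen hT hi₂]
        omega
  · push Not at hbefore
    have hc := hquad (by omega) (by omega) hW₁ hW
    refine hpow ?_ (hP.mem_pow (wordVal_quad hc) (wordVal (T.take i₁)) v _ l ?_)
    · simp only [List.length_append, length_invWord, List.length_take, List.length_drop]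
      omega
    · intro S hS hvS hvS'
      have e1 := hbefore f hlevf S hS
      have e2 := hbefore 1 hlev1 S hS
      rw [one_mul] at e2
      rw [pathSum_quad _ _ hc, hstart hW₁, hseg (by omega) (by omega), e1, e2,
        pathSum_eq_zero_of_far hgen (f := f) hW₁K _ hS, add_zero, sub_zero, zero_sub, neg_ne_zero]
      · exact pathSum_cosetInd_geodesic hgen hgeod hq hxl hS hvS hvS'
      · rw [conjLevel_take hgen hT (by omega)]
        omega

end Confinement

section Pigeonhole

lemma sum_Ioc_blocks (F : ℕ → ℕ) (k D S : ℕ) :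
    ∑ s ∈ Finset.range S, ∑ j ∈ Finset.Ioc (k + D * s) (k + D * (s + 1)), F j =
      ∑ j ∈ Finset.Ioc k (k + D * S), F j := by
  induction S with
  | zero => simp
  | succ S ih =>
    rw [Finset.sum_range_succ, ih]
    exact Finset.sum_Ioc_consecutive F (by omega) (by gcongr; omega)

lemma exists_le_of_sum_Ioc_lt {F : ℕ → ℕ} {a D K : ℕ}
    (h : ∑ j ∈ Finset.Ioc a (a + D), F j < (K + 1) * D) :
    ∃ j, a < j ∧ j ≤ a + D ∧ F j ≤ K := by
  by_contra! hF
  have := Finset.card_nsmul_le_sum (Finset.Ioc a (a + D)) F (K + 1) fun j hj => by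
    rw [Finset.mem_Ioc] at hj
    exact hF j hj.1 hj.2
  rw [Nat.card_Ioc, smul_eq_mul, Nat.add_sub_cancel_left, mul_comm] at this
  exact absurd h (not_lt.2 this)

lemma card_mul_le_sum_of_filter {B : ℕ → ℕ} {S N τ : ℕ}
    (h : ((Finset.range S).filter fun s => B s < τ).card ≤ N) :
    S * τ ≤ ∑ s ∈ Finset.range S, B s + N * τ := by
  have h1 := Finset.card_filter_add_card_filter_not (s := Finset.range S) (fun s => B s < τ)
  have h2 := Finset.card_nsmul_le_sum ((Finset.range S).filter fun s => ¬B s < τ) B τ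
    fun s hs => not_lt.1 (Finset.mem_filter.1 hs).2
  have h3 := Finset.sum_le_sum_of_subset (f := B)
    (Finset.filter_subset (fun s => ¬B s < τ) (Finset.range S))
  rw [Finset.card_range] at h1
  rw [smul_eq_mul] at h2
  nlinarith

variable {G : Type*} [Group G] {Λ : Type*} {H : Λ → Subgroup G} {X : Set G}
variable {R : Set (RelFree H X)} {Ω : Set G} {A B L : ℕ}

open scoped Pointwise in
lemma finite_pow {Z : Set G} (hZ : Z.Finite) (n : ℕ) : (Z ^ n).Finite := by
  induction n with
  | zero => simp
  | succ n ih =>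
    rw [pow_succ]
    exact ih.mul hZ

open scoped Pointwise in
lemma wordVal_mem_pow {Z : Set G} {K : ℕ} {w : List (RelLetter H X)} (hw : w.length ≤ K)
    (hZ : ∀ x ∈ w, x.val ∈ Z) : wordVal w ∈ (insert 1 Z) ^ K := by
  refine Set.pow_subset_pow_right (Set.mem_insert _ _) hw ?_
  clear hw
  induction w with
  | nil => simp
  | cons x w ih =>
    rw [wordVal_cons, List.length_cons, pow_succ']
    exact Set.mul_mem_mul (Set.mem_insert_of_mem _ (hZ x (by simp)))
      (ih fun y hy => hZ y (by simp [hy]))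

open scoped Pointwise in
/-- The level of a conjugator is bounded in terms of the lengths of the conjugate elements. -/
theorem LinearPres.exists_conjLevel_le (hP : LinearPres H X R Ω A B L) (hΩ : Ω.Finite)
    (hX : X.Finite) (k : ℕ) :
    ∃ ρ : ℕ, ∀ f t : G, letterLen H X f ≤ k → letterLen H X (t⁻¹ * f * t) ≤ k →
      conjLevel H X f t ≤ ρ := by
  have hgen := hP.gen
  set M := (2 * L + 1) * (2 * L + 2) with hM
  set c := 2 * A * M with hc
  set e := (2 * A * k + B) * M with he
  set K := 5 * c + 1 + 4 with hK
  set D := 2 * K + 2 with hD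
  let Z : Set G := (insert 1 Ω) ^ ((A * (2 * K + 2 * (5 * D)) + B) * L) ∪ (X ∪ X⁻¹)
  have hZ : ((insert 1 Z) ^ K : Set G).Finite :=
    finite_pow (((finite_pow (hΩ.insert 1) _).union (hX.union hX.inv)).insert 1) _
  set N := hZ.toFinset.card with hN
  set S₀ := N * (5 * c + 2) * D + c * (2 * k + 5 * D) + e with hS₀
  refine ⟨2 * k + 5 * D * (S₀ + 1), fun f t hf hg => ?_⟩
  obtain ⟨t', ht', hconj⟩ := exists_conjLevel (H := H) (X := X) f t
  obtain ⟨T, hTl, rfl⟩ := exists_geodesic_word hgen t'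
  obtain ⟨U, hUl, hU⟩ := exists_geodesic_word hgen f
  obtain ⟨V, hVl, hV⟩ := exists_geodesic_word hgen (t⁻¹ * f * t)
  have hT : conjLevel H X f (wordVal T) = T.length := by
    rw [conjLevel_congr hconj, ← ht', hTl]
  rw [← ht', ← hTl]
  set F : ℕ → ℕ := fun j =>
    letterLen H X ((wordVal (T.take j))⁻¹ * f * wordVal (T.take j)) - 4 with hF
  have hsum : ∑ j ∈ Finset.Ioc k (T.length - k), F j ≤ c * T.length + e := by
    refine (hP.sum_displacement_le (V := V) (k := k) hU (by omega) (by omega) hT ?_).trans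
      (le_of_eq ?_)
    · rw [hU, hV, ← hconj]
      group
    · rw [hc, he, ← hM]
      ring
  set S := (T.length - 2 * k) / (5 * D) with hS
  have hSle : 5 * D * S ≤ T.length - 2 * k := Nat.mul_div_le _ _
  have hSlt : T.length - 2 * k < 5 * D * (S + 1) := by
    exact Nat.lt_mul_div_succ _ (by omega : 0 < 5 * D)
  set Bl : ℕ → ℕ := fun s => ∑ j ∈ Finset.Ioc (k + 5 * D * s) (k + 5 * D * (s + 1)), F j with hBl
  have hblocks : ∑ s ∈ Finset.range S, Bl s ≤ c * T.length + e := by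
    rw [hBl, sum_Ioc_blocks]
    rcases Nat.eq_zero_or_pos S with h0 | h0
    · simp [h0]
    · refine (Finset.sum_le_sum_of_subset (Finset.Ioc_subset_Ioc_right ?_)).trans hsum
      have : 0 < 5 * D * S := by positivity
      omega
  have hgood : ∀ s ∈ (Finset.range S).filter fun s => Bl s < (5 * c + 1 + 1) * D,
      ∃ i, k + 5 * D * s < i ∧ i ≤ k + 5 * D * (s + 1) ∧ i ≤ T.length ∧
        (wordVal (T.take i))⁻¹ * f * wordVal (T.take i) ∈ (insert 1 Z) ^ K := by
    intro s hs
    obtain ⟨hsS, hsB⟩ := Finset.mem_filter.1 hs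
    have hs1 : 5 * D * (s + 1) ≤ 5 * D * S := Nat.mul_le_mul_left _ (Finset.mem_range.1 hsS)
    have hs2 : 5 * D * (s + 1) = 5 * D * s + 5 * D := by ring
    have hsub : ∀ m ≤ 4, ∃ j, k + 5 * D * s + m * D < j ∧ j ≤ k + 5 * D * s + m * D + D ∧
        F j ≤ 5 * c + 1 := by
      intro m hm
      apply exists_le_of_sum_Ioc_lt
      refine lt_of_le_of_lt (Finset.sum_le_sum_of_subset (Finset.Ioc_subset_Ioc ?_ ?_)) hsB
      · omega
      · have : m * D ≤ 4 * D := Nat.mul_le_mul_right _ hm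
        omega
    obtain ⟨i₁, h₁, h₁', hF₁⟩ := hsub 0 (by omega)
    obtain ⟨i, h, h', hFi⟩ := hsub 2 (by omega)
    obtain ⟨i₂, h₂, h₂', hF₂⟩ := hsub 4 (by omega)
    obtain ⟨W₁, hW₁l, hW₁⟩ :=
      exists_geodesic_word hgen ((wordVal (T.take i₁))⁻¹ * f * wordVal (T.take i₁))
    obtain ⟨W, hWl, hW⟩ :=
      exists_geodesic_word hgen ((wordVal (T.take i))⁻¹ * f * wordVal (T.take i))
    obtain ⟨W₂, hW₂l, hW₂⟩ :=
      exists_geodesic_word hgen ((wordVal (T.take i₂))⁻¹ * f * wordVal (T.take i₂))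
    simp only [hF] at hF₁ hFi hF₂
    refine ⟨i, by omega, by omega, by omega, ?_⟩
    rw [← hW]
    refine wordVal_mem_pow (by omega) fun x hx => ?_
    exact hP.letters_confined hT (by omega) (by omega) (by omega) (by omega) (by omega)
      (by omega) (by omega) hW₁ hW hW₂ (by rw [hWl, hW]) hx
  have hcard : ((Finset.range S).filter fun s => Bl s < (5 * c + 1 + 1) * D).card ≤ N := by
    choose! i hi1 hi2 hi3 hi4 using hgood
    refine Finset.card_le_card_of_injOn
      (fun s => (wordVal (T.take (i s)))⁻¹ * f * wordVal (T.take (i s)))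
      (fun s hs => hZ.mem_toFinset.2 (hi4 s hs)) fun s hs s' hs' hss => ?_
    have h := conjLevel_congr (H := H) (X := X) hss
    rw [conjLevel_take hgen hT (hi3 s hs), conjLevel_take hgen hT (hi3 s' hs')] at h
    have h1 := hi1 s hs
    have h2 := hi2 s hs
    have h1' := hi1 s' hs'
    have h2' := hi2 s' hs'
    rw [h] at h1 h2
    have l1 : 5 * D * s < 5 * D * (s' + 1) := by omega
    have l2 : 5 * D * s' < 5 * D * (s + 1) := by omega
    have l3 := Nat.lt_of_mul_lt_mul_left l1
    have l4 := Nat.lt_of_mul_lt_mul_left l2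
    omega
  have hmain := card_mul_le_sum_of_filter hcard
  have hn : T.length ≤ 2 * k + 5 * D * (S + 1) := by omega
  have hSS : S ≤ S₀ := by
    have h1 : c * T.length ≤ c * (2 * k + 5 * D * (S + 1)) := Nat.mul_le_mul_left _ hn
    have h2 : S * ((5 * c + 1 + 1) * D) ≤ c * (2 * k + 5 * D * (S + 1)) + e +
        N * ((5 * c + 1 + 1) * D) := by omega
    have h3 : S * 1 ≤ S * (2 * D) := Nat.mul_le_mul_left _ (by omega)
    nlinarith
  refine hn.trans ?_
  gcongr

end Pigeonhole

end RelHyp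

namespace RelHyp

section Comparison

variable {G : Type*} [Group G] {Λ : Type*} {H : Λ → Subgroup G} {X Y S : Set G}

lemma apply_list_prod_le {φ : G → ℕ} {c : ℕ} (h1 : φ 1 = 0)
    (hmul : ∀ g h, φ (g * h) ≤ φ g + φ h) {w : List G} (hw : ∀ x ∈ w, φ x ≤ c) :
    φ w.prod ≤ c * w.length := by
  induction w with
  | nil => simp [h1]
  | cons x w ih =>
    have hx := hw x (by simp)
    have hih := ih fun y hy => hw y (by simp [hy])
    have := hmul x w.prod
    rw [List.prod_cons, List.length_cons]
    linarith

lemma wordLength_prod_le {w : List G} (hw : ∀ x ∈ w, x ∈ S ∨ x⁻¹ ∈ S) :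
    wordLength S w.prod ≤ w.length :=
  Nat.sInf_le ⟨w, rfl, hw, rfl⟩

lemma exists_wordLength_eq (hS : Subgroup.closure S = ⊤) (g : G) :
    ∃ w : List G, w.length = wordLength S g ∧ (∀ x ∈ w, x ∈ S ∨ x⁻¹ ∈ S) ∧ w.prod = g := by
  have hmem : g ∈ (Subgroup.closure S).toSubmonoid := by simp [hS]
  rw [Subgroup.closure_toSubmonoid] at hmem
  obtain ⟨w, hw, hg⟩ := Submonoid.exists_list_of_mem_closure hmem
  exact Nat.sInf_mem
    (s := {n | ∃ w : List G, w.length = n ∧ (∀ x ∈ w, x ∈ S ∨ x⁻¹ ∈ S) ∧ w.prod = g})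
    ⟨_, w, rfl, hw, hg⟩

lemma wordLength_mul_le (hS : Subgroup.closure S = ⊤) (g h : G) :
    wordLength S (g * h) ≤ wordLength S g + wordLength S h := by
  obtain ⟨v, hv, hvS, rfl⟩ := exists_wordLength_eq hS g
  obtain ⟨w, hw, hwS, rfl⟩ := exists_wordLength_eq hS h
  rw [← hv, ← hw, ← List.prod_append, ← List.length_append]
  refine wordLength_prod_le fun x hx => ?_
  rcases List.mem_append.1 hx with hx | hx
  exacts [hvS x hx, hwS x hx]

lemma closure_union_iUnion_eq_top (hX : Subgroup.closure X = ⊤) :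
    Subgroup.closure (X ∪ ⋃ l, (H l : Set G)) = ⊤ :=
  top_unique (hX ▸ Subgroup.closure_mono Set.subset_union_left)

lemma exists_letterLen_le_mul_relLen (hX : X.Finite) (hXgen : Subgroup.closure X = ⊤)
    (hgen : RelGenerates H Y) :
    ∃ c : ℕ, ∀ g : G, letterLen H Y g ≤ c * relLen H X g := by
  obtain ⟨c, hc⟩ := (hX.image (letterLen H Y)).bddAbove
  have hS : ∀ x ∈ X ∪ ⋃ l, (H l : Set G), letterLen H Y x ≤ c + 1 := by
    rintro x (hx | hx)
    · exact (hc (Set.mem_image_of_mem _ hx)).trans (Nat.le_succ c)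
    · obtain ⟨l, hl⟩ := Set.mem_iUnion.1 hx
      exact (letterLen_le_one_of_mem hl).trans (Nat.le_add_left 1 c)
  refine ⟨c + 1, fun g => ?_⟩
  obtain ⟨w, hw, hwS, hg⟩ :=
    exists_wordLength_eq (closure_union_iUnion_eq_top (H := H) hXgen) g
  rw [relLen, ← hw, ← hg]
  refine apply_list_prod_le (Nat.le_zero.1 (letterLen_wordVal_le (H := H) (X := Y) []))
    (letterLen_mul_le hgen) fun x hx => ?_
  rcases hwS x hx with h | h
  · exact hS x h
  · simpa using (letterLen_inv_le hgen x⁻¹).trans (hS _ h)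

lemma exists_relLen_le_mul_letterLen (hY : Y.Finite) (hXgen : Subgroup.closure X = ⊤)
    (hgen : RelGenerates H Y) :
    ∃ c : ℕ, ∀ g : G, relLen H X g ≤ c * letterLen H Y g := by
  obtain ⟨c, hc⟩ := ((hY.union hY.inv).image (relLen H X)).bddAbove
  refine ⟨c + 1, fun g => ?_⟩
  obtain ⟨w, hw, hg⟩ := exists_geodesic_word hgen g
  rw [← hw, ← hg, wordVal, ← w.length_map (f := RelLetter.val)]
  refine apply_list_prod_le (Nat.le_zero.1 (wordLength_prod_le (w := []) (by simp)))
    (wordLength_mul_le (closure_union_iUnion_eq_top hXgen)) fun x hx => ?_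
  obtain ⟨y, -, rfl⟩ := List.mem_map.1 hx
  rcases y with ⟨l, h⟩ | ⟨x, b⟩
  · have : relLen H X [(h.1 : G)].prod ≤ 1 := wordLength_prod_le (w := [(h.1 : G)]) (by
      simpa using Or.inl (Or.inr ⟨l, h.1.2⟩))
    rw [List.prod_singleton] at this
    exact this.trans (Nat.le_add_left 1 c)
  · refine (hc (Set.mem_image_of_mem _ ?_)).trans (Nat.le_succ c)
    cases b <;> simp [RelLetter.val]

/-- A finite relative presentation with a linear isoperimetric function yields `LinearPres`. -/
lemma IsFiniteRelPres.exists_linearPres {R : Set (RelFree H Y)} (hR : IsFiniteRelPres H Y R)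
    {A B : ℕ} (hAB : IsIsoperFn H Y R fun n => A * n + B) :
    ∃ (Ω : Set G) (L : ℕ), Ω.Finite ∧ LinearPres H Y R Ω A B L := by
  choose wr hwr using exists_wordToF_eq (H := H) (X := Y)
  obtain ⟨L, hL⟩ := (hR.finR.image fun r => (wr r).length).bddAbove
  refine ⟨⋃ r ∈ R, ⋃ x ∈ {x | x ∈ wr r}, {x.val, x.val⁻¹}, L,
    hR.finR.biUnion fun r _ => (List.finite_toSet _).biUnion fun x _ => Set.toFinite _, ?_, hAB,
    fun r hr => ?_, fun r hr => ⟨wr r, hwr r, hL (Set.mem_image_of_mem _ hr), fun x hx => ?_⟩⟩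
  · intro g
    obtain ⟨r, rfl⟩ := hR.surj g
    exact ⟨wr r, by rw [← relEps_wordToF, hwr]⟩
  · rw [← MonoidHom.mem_ker, hR.ker]
    exact Subgroup.subset_normalClosure hr
  · simp only [Set.mem_iUnion]
    exact ⟨⟨r, hr, x, hx, by simp⟩, ⟨r, hr, x, hx, by simp⟩⟩

end Comparison

end RelHyp

/-- Corollary 3.38. Let `G` be generated by a finite set `X` and hyperbolic
relative to `{H₁,…,H_m}`. For any `k ≥ 0` there exists `ρ = ρ(k)` such that any two conjugate
elements `f, g ∈ G` with `max{|f|_{X∪𝓗}, |g|_{X∪𝓗}} ≤ k` are conjugate by an element `t` with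
`|t|_{X∪𝓗} ≤ ρ`. -/
theorem statement_12 {G : Type*} [Group G] {m : ℕ} (H : Fin m → Subgroup G)
    (X : Set G) (hXfin : X.Finite) (hXgen : Subgroup.closure X = ⊤)
    (hhyp : IsRelHyperbolic H) :
    ∀ k : ℕ, ∃ ρ : ℕ,
      ∀ f g : G, IsConj f g → relLen H X f ≤ k → relLen H X g ≤ k →
        ∃ t : G, t⁻¹ * f * t = g ∧ relLen H X t ≤ ρ := by
  intro k
  obtain ⟨Y, R, hR, A, B, hAB⟩ := hhyp
  obtain ⟨Ω, L, hΩ, hP⟩ := hR.exists_linearPres hAB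
  obtain ⟨c, hc⟩ := exists_letterLen_le_mul_relLen hXfin hXgen hP.gen
  obtain ⟨d, hd⟩ := exists_relLen_le_mul_letterLen hR.finX hXgen hP.gen
  obtain ⟨ρ, hρ⟩ := hP.exists_conjLevel_le hΩ hR.finX (c * k)
  refine ⟨d * ρ, fun f g hfg hf hg => ?_⟩
  obtain ⟨u, hu⟩ := isConj_iff.1 hfg.symm
  have hu' : u⁻¹ * f * u = g := by
    rw [← hu]
    group
  obtain ⟨t, ht, htu⟩ := exists_conjLevel (H := H) (X := Y) f u
  refine ⟨t, htu.trans hu', (hd t).trans (Nat.mul_le_mul_left _ ?_)⟩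
  rw [ht]
  refine hρ f u ((hc f).trans (Nat.mul_le_mul_left _ hf)) ?_
  rw [hu']
  exact (hc g).trans (Nat.mul_le_mul_left _ hg)
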